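/- For any p.d.f.s of two weighted one-dimensional-variance spherical Gaussian components p = w₁·g_{μ₁,σ₁} and q = w₂·g_{μ₂,σ₂} in ℝ^d, the L¹ distance satisfies ‖p − q‖₁ ≤ |w₁ − w₂| + min{w₁,w₂}·( √(2π)·‖μ₁ − μ₂‖₂/σ₂ + √(d·|σ₁² − σ₂²|)/σ₂ + √(2d·ln(σ₂/σ₁)) ). -/

import Mathlib

open Real MeasureTheory

/-- Spherical Gaussian density with mean `μ` and covariance `(σ²/2π)·I` on `ℝ^d`. -/
noncomputable def sphericalGaussian (d : ℕ) (μ : EuclideanSpace ℝ (Fin d)) (σ : ℝ)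
    (x : EuclideanSpace ℝ (Fin d)) : ℝ :=
  (σ ^ d)⁻¹ * Real.exp (-π * ‖x - μ‖ ^ 2 / σ ^ 2)

open InformationTheory in
lemma three_mul_sub_one_sq_le_klFun {t : ℝ} (ht : 0 ≤ t) :
    3 * (t - 1) ^ 2 ≤ (4 + 2 * t) * klFun t := by
  set h : ℝ → ℝ := fun t ↦ (4 + 2 * t) * klFun t - 3 * (t - 1) ^ 2 with h_def
  have hcont : Continuous h := by
    have := continuous_klFun
    fun_prop
  have hderiv (x : ℝ) (hx : 0 < x) :
      HasDerivAt h (4 * ((x + 1) * log x - 2 * (x - 1))) x := by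
    have h₁ : HasDerivAt (fun t : ℝ ↦ 4 + 2 * t) 2 x := by
      simpa using ((hasDerivAt_id x).const_mul 2).const_add 4
    have h₂ : HasDerivAt (fun t : ℝ ↦ 3 * (t - 1) ^ 2) (6 * (x - 1)) x := by
      convert! (((hasDerivAt_id x).sub_const 1).pow 2).const_mul 3 using 1
      simp
      ring
    convert! (h₁.mul (hasDerivAt_klFun hx.ne')).sub h₂ using 1
    rw [klFun_apply]
    ring
  have hlog (x : ℝ) (hx : 1 ≤ x) : 2 * (x - 1) ≤ (x + 1) * log x := by
    have := le_log_one_add_of_nonneg (sub_nonneg.2 hx)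
    rw [div_le_iff₀ (by linarith), add_sub_cancel] at this
    linarith
  have h_one : h 1 = 0 := by simp [h_def, klFun_one]
  suffices 0 ≤ h t by simpa [h_def] using this
  rcases le_total 1 t with h1 | h1
  · have hmono : MonotoneOn h (Set.Ici 1) := by
      refine monotoneOn_of_deriv_nonneg (convex_Ici 1) hcont.continuousOn ?_ ?_ <;>
        rw [interior_Ici] <;> intro x (hx : 1 < x)
      · exact (hderiv x (by linarith)).differentiableAt.differentiableWithinAt
      · rw [(hderiv x (by linarith)).deriv]
        linarith [hlog x hx.le]
    exact h_one ▸ hmono (Set.mem_Ici.2 le_rfl) h1 h1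
  · have hanti : AntitoneOn h (Set.Icc 0 1) := by
      refine antitoneOn_of_deriv_nonpos (convex_Icc 0 1) hcont.continuousOn ?_ ?_ <;>
        rw [interior_Icc] <;> intro x hx
      · exact (hderiv x hx.1).differentiableAt.differentiableWithinAt
      · rw [(hderiv x hx.1).deriv]
        have hx₀ := hx.1
        have := hlog x⁻¹ ((one_le_inv₀ hx.1).2 hx.2.le)
        rw [log_inv] at this
        have := mul_le_mul_of_nonneg_left this hx₀.le
        have e₁ : x * (2 * (x⁻¹ - 1)) = 2 * (1 - x) := by field_simp
        have e₂ : x * ((x⁻¹ + 1) * -log x) = -((x + 1) * log x) := by field_simp; ring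
        linarith
    exact h_one ▸ hanti ⟨ht, h1⟩ ⟨zero_le_one, le_rfl⟩ h1

/-- Pinsker's inequality for positive densities. -/
theorem integral_abs_sub_le_sqrt_integral_mul_log {α : Type*} [MeasurableSpace α] {μ : Measure α}
    {p q : α → ℝ} (hp : ∀ x, 0 < p x) (hq : ∀ x, 0 < q x)
    (hp_int : Integrable p μ) (hq_int : Integrable q μ)
    (hp_one : ∫ x, p x ∂μ = 1) (hq_one : ∫ x, q x ∂μ = 1)
    (hpq : Integrable (fun x ↦ p x * log (p x / q x)) μ) :
    ∫ x, |p x - q x| ∂μ ≤ √(2 * ∫ x, p x * log (p x / q x) ∂μ) := by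
  set S := ∫ x, |p x - q x| ∂μ
  set D := ∫ x, p x * log (p x / q x) ∂μ with hD
  have hS : 0 ≤ S := integral_nonneg fun x ↦ abs_nonneg _
  rcases hS.eq_or_lt with hS | hS
  · exact hS ▸ sqrt_nonneg _
  have hpt (c : ℝ) (hc : 0 < c) (x : α) : |p x - q x| ≤
      c / 6 * (4 * q x + 2 * p x) + (2 * c)⁻¹ * (p x * log (p x / q x) + q x - p x) := by
    have hpx := hp x
    have hqx := hq x
    set K := p x * log (p x / q x) + q x - p x with hK
    have key : 3 * (p x - q x) ^ 2 ≤ (4 * q x + 2 * p x) * K := by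
      have := mul_le_mul_of_nonneg_left
        (three_mul_sub_one_sq_le_klFun (div_pos hpx hqx).le) (sq_nonneg (q x))
      rw [InformationTheory.klFun_apply] at this
      have e₁ : q x ^ 2 * (3 * (p x / q x - 1) ^ 2) = 3 * (p x - q x) ^ 2 := by field_simp
      have e₂ : q x ^ 2 * ((4 + 2 * (p x / q x)) *
          (p x / q x * log (p x / q x) + 1 - p x / q x)) = (4 * q x + 2 * p x) * K := by
        rw [hK]
        generalize log (p x / q x) = l
        field_simp
      linarith
    have hA : 0 < 4 * q x + 2 * p x := by positivity
    have hK₀ : 0 ≤ K := by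
      by_contra! hneg
      nlinarith [mul_neg_of_pos_of_neg hA hneg, sq_nonneg (p x - q x)]
    refine abs_le_of_sq_le_sq ?_ (by positivity)
    have e : c / 6 * (2 * c)⁻¹ = 1 / 12 := by field_simp; norm_num
    nlinarith [sq_nonneg (c / 6 * (4 * q x + 2 * p x) - (2 * c)⁻¹ * K)]
  have hi₁ : Integrable (fun x ↦ 4 * q x + 2 * p x) μ :=
    (hq_int.const_mul 4).add (hp_int.const_mul 2)
  have hi₂ : Integrable (fun x ↦ p x * log (p x / q x) + q x) μ := hpq.add hq_int
  have hi₃ : Integrable (fun x ↦ p x * log (p x / q x) + q x - p x) μ := hi₂.sub hp_int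
  have hi : Integrable (fun x ↦ |p x - q x|) μ := (hp_int.sub hq_int).abs
  have hSc : S ≤ S / 2 + S⁻¹ * D := by
    have hmono := integral_mono hi
      ((hi₁.const_mul (S / 2 / 6)).add (hi₃.const_mul (2 * (S / 2))⁻¹)) (hpt (S / 2) (by linarith))
    simp only [Pi.add_apply] at hmono
    rw [integral_add (hi₁.const_mul _) (hi₃.const_mul _), integral_const_mul, integral_const_mul,
      integral_add (hq_int.const_mul 4) (hp_int.const_mul 2), integral_const_mul,
      integral_const_mul, integral_sub hi₂ hp_int, integral_add hpq hq_int,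
      hp_one, hq_one, ← hD] at hmono
    calc S ≤ _ := hmono
      _ = _ := by ring_nf
  apply le_sqrt_of_sq_le
  have := mul_le_mul_of_nonneg_left hSc hS.le
  have e : S * (S⁻¹ * D) = D := by field_simp
  nlinarith

section GaussianMoments

variable {V : Type*} [NormedAddCommGroup V] [InnerProductSpace ℝ V] [FiniteDimensional ℝ V]
  [MeasurableSpace V] [BorelSpace V] {b : ℝ}

lemma integrable_norm_pow_mul_exp_neg_mul_sq_norm (hb : 0 < b) (k : ℕ) :
    Integrable fun v : V ↦ ‖v‖ ^ k * rexp (-b * ‖v‖ ^ 2) := by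
  rcases subsingleton_or_nontrivial V with h | h
  · have hfin : IsFiniteMeasure (volume : Measure V) :=
      ⟨(Set.subsingleton_of_subsingleton (s := Set.univ)).isCompact.measure_lt_top⟩
    have : (fun v : V ↦ ‖v‖ ^ k * rexp (-b * ‖v‖ ^ 2)) =
        fun _ ↦ ‖(0 : V)‖ ^ k * rexp (-b * ‖(0 : V)‖ ^ 2) := by
      ext v; rw [Subsingleton.elim v 0]
    rw [this]
    exact integrable_const _
  · rw [integrable_fun_norm_addHaar volume (f := fun r : ℝ ↦ r ^ k * rexp (-b * r ^ 2))]
    have := integrableOn_rpow_mul_exp_neg_mul_sq hb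
      (s := ((Module.finrank ℝ V - 1 + k : ℕ) : ℝ)) (neg_one_lt_zero.trans_le (Nat.cast_nonneg _))
    simpa only [rpow_natCast, pow_add, mul_assoc, smul_eq_mul] using this

lemma integrable_exp_neg_mul_sq_norm (hb : 0 < b) :
    Integrable fun v : V ↦ rexp (-b * ‖v‖ ^ 2) := by
  simpa using integrable_norm_pow_mul_exp_neg_mul_sq_norm (V := V) hb 0

lemma integral_sq_norm_mul_exp_neg_mul_sq_norm (hb : 0 < b) :
    ∫ v : V, ‖v‖ ^ 2 * rexp (-b * ‖v‖ ^ 2) =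
      Module.finrank ℝ V / (2 * b) * ∫ v : V, rexp (-b * ‖v‖ ^ 2) := by
  rcases subsingleton_or_nontrivial V with h | h
  · have (v : V) : ‖v‖ = 0 := by rw [Subsingleton.elim v 0, norm_zero]
    simp [this, Module.finrank_zero_of_subsingleton]
  set n := Module.finrank ℝ V
  rw [integral_fun_norm_addHaar volume (fun r : ℝ ↦ r ^ 2 * rexp (-b * r ^ 2)),
    integral_fun_norm_addHaar volume (fun r : ℝ ↦ rexp (-b * r ^ 2))]
  have hk (k : ℕ) : ∫ y in Set.Ioi (0 : ℝ), y ^ k * rexp (-b * y ^ 2) =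
      b ^ (-((k : ℝ) + 1) / 2) * (1 / 2) * Gamma (((k : ℝ) + 1) / 2) := by
    have := integral_rpow_mul_exp_neg_mul_rpow two_pos
      (q := (k : ℝ)) (neg_one_lt_zero.trans_le (Nat.cast_nonneg _)) hb
    simpa only [rpow_natCast, rpow_two] using this
  have h₂ : ∫ y in Set.Ioi (0 : ℝ), y ^ (n - 1) • (y ^ 2 * rexp (-b * y ^ 2)) =
      n / (2 * b) * ∫ y in Set.Ioi (0 : ℝ), y ^ (n - 1) • rexp (-b * y ^ 2) := by
    simp only [smul_eq_mul, ← mul_assoc, ← pow_add]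
    rw [hk, hk]
    obtain ⟨m, hm⟩ : ∃ m, n = m + 1 := Nat.exists_eq_add_one.2 Module.finrank_pos
    rw [hm]
    simp only [Nat.add_sub_cancel]
    push_cast
    rw [show ((m : ℝ) + 2 + 1) / 2 = (m + 1) / 2 + 1 by ring, Gamma_add_one (by positivity),
      show -((m : ℝ) + 2 + 1) / 2 = -(m + 1) / 2 - 1 by ring, rpow_sub_one hb.ne']
    field_simp
  rw [h₂]
  simp only [smul_eq_mul, nsmul_eq_mul]
  ring

lemma integrable_inner_mul_exp_neg_mul_sq_norm (hb : 0 < b) (w : V) :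
    Integrable fun v : V ↦ inner ℝ v w * rexp (-b * ‖v‖ ^ 2) := by
  refine ((integrable_norm_pow_mul_exp_neg_mul_sq_norm hb 1).const_mul ‖w‖).mono'
    (by fun_prop) (.of_forall fun v ↦ ?_)
  rw [norm_mul, norm_of_nonneg (exp_pos _).le, pow_one, ← mul_assoc, mul_comm ‖w‖]
  gcongr
  exact norm_inner_le_norm v w

lemma integral_inner_mul_exp_neg_mul_sq_norm (w : V) :
    ∫ v : V, inner ℝ v w * rexp (-b * ‖v‖ ^ 2) = 0 := by
  have := integral_neg_eq_self (fun v : V ↦ inner ℝ v w * rexp (-b * ‖v‖ ^ 2)) volume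
  simp only [inner_neg_left, norm_neg, neg_mul, integral_neg] at this
  simp only [neg_mul]
  linarith

end GaussianMoments

section SphericalGaussian

variable {d : ℕ} {σ : ℝ} (μ : EuclideanSpace ℝ (Fin d))

lemma sphericalGaussian_eq (x : EuclideanSpace ℝ (Fin d)) :
    sphericalGaussian d μ σ x = (σ ^ d)⁻¹ * rexp (-(π / σ ^ 2) * ‖x - μ‖ ^ 2) := by
  rw [sphericalGaussian]
  ring_nf

lemma sphericalGaussian_pos (hσ : 0 < σ) (x : EuclideanSpace ℝ (Fin d)) :
    0 < sphericalGaussian d μ σ x := by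
  unfold sphericalGaussian
  positivity

lemma log_sphericalGaussian (hσ : 0 < σ) (x : EuclideanSpace ℝ (Fin d)) :
    log (sphericalGaussian d μ σ x) = -(d * log σ) - π / σ ^ 2 * ‖x - μ‖ ^ 2 := by
  rw [sphericalGaussian_eq, log_mul (by positivity) (exp_pos _).ne', log_inv, log_pow, log_exp]
  ring

lemma integrable_sphericalGaussian (hσ : 0 < σ) : Integrable (sphericalGaussian d μ σ) := by
  simp_rw [funext (sphericalGaussian_eq μ)]
  exact ((integrable_exp_neg_mul_sq_norm (by positivity)).comp_sub_right μ).const_mul _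

lemma integral_exp_neg_pi_div_sq_mul_sq_norm (hσ : 0 < σ) :
    ∫ x : EuclideanSpace ℝ (Fin d), rexp (-(π / σ ^ 2) * ‖x‖ ^ 2) = σ ^ d := by
  rw [GaussianFourier.integral_rexp_neg_mul_sq_norm (by positivity), finrank_euclideanSpace_fin,
    div_div_cancel₀ pi_ne_zero, ← rpow_natCast, ← rpow_mul hσ.le,
    ← rpow_natCast]
  congr 1
  push_cast
  ring

lemma integral_sphericalGaussian (hσ : 0 < σ) : ∫ x, sphericalGaussian d μ σ x = 1 := by
  simp_rw [sphericalGaussian_eq]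
  rw [integral_const_mul, integral_sub_right_eq_self (fun x ↦ rexp (-(π / σ ^ 2) * ‖x‖ ^ 2)) μ,
    integral_exp_neg_pi_div_sq_mul_sq_norm hσ, inv_mul_cancel₀ (by positivity)]

lemma sphericalGaussian_add_mul_sq_norm_sub (c y : EuclideanSpace ℝ (Fin d)) :
    sphericalGaussian d μ σ (y + μ) * ‖y + μ - c‖ ^ 2 = (σ ^ d)⁻¹ *
      (‖y‖ ^ 2 * rexp (-(π / σ ^ 2) * ‖y‖ ^ 2) +
        2 * (inner ℝ y (μ - c) * rexp (-(π / σ ^ 2) * ‖y‖ ^ 2)) +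
        ‖μ - c‖ ^ 2 * rexp (-(π / σ ^ 2) * ‖y‖ ^ 2)) := by
  rw [sphericalGaussian_eq, add_sub_cancel_right, add_sub_assoc, norm_add_sq_real]
  ring

lemma integrable_sphericalGaussian_mul_sq_norm_sub (hσ : 0 < σ)
    (c : EuclideanSpace ℝ (Fin d)) :
    Integrable fun x ↦ sphericalGaussian d μ σ x * ‖x - c‖ ^ 2 := by
  have hb : 0 < π / σ ^ 2 := by positivity
  suffices Integrable fun y ↦ sphericalGaussian d μ σ (y + μ) * ‖y + μ - c‖ ^ 2 by
    simpa using this.comp_sub_right μ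
  simp_rw [sphericalGaussian_add_mul_sq_norm_sub]
  exact (((integrable_norm_pow_mul_exp_neg_mul_sq_norm hb 2).add
    ((integrable_inner_mul_exp_neg_mul_sq_norm hb _).const_mul 2)).add
    ((integrable_exp_neg_mul_sq_norm hb).const_mul _)).const_mul _

lemma integral_sphericalGaussian_mul_sq_norm_sub (hσ : 0 < σ) (c : EuclideanSpace ℝ (Fin d)) :
    ∫ x, sphericalGaussian d μ σ x * ‖x - c‖ ^ 2 = d * σ ^ 2 / (2 * π) + ‖μ - c‖ ^ 2 := by
  have hb : 0 < π / σ ^ 2 := by positivity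
  have i₁ := integrable_norm_pow_mul_exp_neg_mul_sq_norm (V := EuclideanSpace ℝ (Fin d)) hb 2
  have i₂ := (integrable_inner_mul_exp_neg_mul_sq_norm hb (μ - c)).const_mul 2
  have i₃ := (integrable_exp_neg_mul_sq_norm (V := EuclideanSpace ℝ (Fin d)) hb).const_mul
    (‖μ - c‖ ^ 2)
  rw [← integral_add_right_eq_self _ μ]
  simp_rw [sphericalGaussian_add_mul_sq_norm_sub]
  rw [integral_const_mul, integral_add (by exact i₁.add i₂) i₃,
    integral_add i₁ i₂, integral_const_mul, integral_const_mul,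
    integral_sq_norm_mul_exp_neg_mul_sq_norm hb, integral_inner_mul_exp_neg_mul_sq_norm,
    integral_exp_neg_pi_div_sq_mul_sq_norm hσ, finrank_euclideanSpace_fin]
  field_simp
  ring

end SphericalGaussian

section TwoSphericalGaussians

variable {d : ℕ} (μ₁ μ₂ : EuclideanSpace ℝ (Fin d)) {σ₁ σ₂ : ℝ}

lemma sphericalGaussian_mul_log_div (hσ₁ : 0 < σ₁) (hσ₂ : 0 < σ₂)
    (x : EuclideanSpace ℝ (Fin d)) :
    sphericalGaussian d μ₁ σ₁ x *
        log (sphericalGaussian d μ₁ σ₁ x / sphericalGaussian d μ₂ σ₂ x) =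
      d * log (σ₂ / σ₁) * sphericalGaussian d μ₁ σ₁ x -
        π / σ₁ ^ 2 * (sphericalGaussian d μ₁ σ₁ x * ‖x - μ₁‖ ^ 2) +
        π / σ₂ ^ 2 * (sphericalGaussian d μ₁ σ₁ x * ‖x - μ₂‖ ^ 2) := by
  rw [log_div (sphericalGaussian_pos μ₁ hσ₁ x).ne' (sphericalGaussian_pos μ₂ hσ₂ x).ne',
    log_sphericalGaussian μ₁ hσ₁, log_sphericalGaussian μ₂ hσ₂, log_div hσ₂.ne' hσ₁.ne']
  ring

lemma integrable_sphericalGaussian_mul_log_div (hσ₁ : 0 < σ₁) (hσ₂ : 0 < σ₂) :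
    Integrable fun x ↦ sphericalGaussian d μ₁ σ₁ x *
      log (sphericalGaussian d μ₁ σ₁ x / sphericalGaussian d μ₂ σ₂ x) := by
  simp_rw [sphericalGaussian_mul_log_div μ₁ μ₂ hσ₁ hσ₂]
  exact (((integrable_sphericalGaussian μ₁ hσ₁).const_mul _).sub
    ((integrable_sphericalGaussian_mul_sq_norm_sub μ₁ hσ₁ μ₁).const_mul _)).add
    ((integrable_sphericalGaussian_mul_sq_norm_sub μ₁ hσ₁ μ₂).const_mul _)

/-- The Kullback-Leibler divergence between two spherical Gaussians. -/
lemma integral_sphericalGaussian_mul_log_div (hσ₁ : 0 < σ₁) (hσ₂ : 0 < σ₂) :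
    ∫ x, sphericalGaussian d μ₁ σ₁ x *
        log (sphericalGaussian d μ₁ σ₁ x / sphericalGaussian d μ₂ σ₂ x) =
      d * log (σ₂ / σ₁) + d * (σ₁ ^ 2 - σ₂ ^ 2) / (2 * σ₂ ^ 2) +
        π * ‖μ₁ - μ₂‖ ^ 2 / σ₂ ^ 2 := by
  have i₁ := (integrable_sphericalGaussian μ₁ hσ₁).const_mul (d * log (σ₂ / σ₁))
  have i₂ := (integrable_sphericalGaussian_mul_sq_norm_sub μ₁ hσ₁ μ₁).const_mul (π / σ₁ ^ 2)
  have i₃ := (integrable_sphericalGaussian_mul_sq_norm_sub μ₁ hσ₁ μ₂).const_mul (π / σ₂ ^ 2)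
  simp_rw [sphericalGaussian_mul_log_div μ₁ μ₂ hσ₁ hσ₂]
  rw [integral_add (by exact i₁.sub i₂) i₃, integral_sub i₁ i₂, integral_const_mul,
    integral_const_mul, integral_const_mul, integral_sphericalGaussian μ₁ hσ₁,
    integral_sphericalGaussian_mul_sq_norm_sub μ₁ hσ₁,
    integral_sphericalGaussian_mul_sq_norm_sub μ₁ hσ₁, sub_self, norm_zero]
  field_simp
  ring

lemma sqrt_add_le_sqrt_add_sqrt (a b : ℝ) : √(a + b) ≤ √a + √b := by
  rw [sqrt_le_left (by positivity)]
  have ha : a ≤ √a ^ 2 := by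
    rcases le_total 0 a with h | h
    · rw [sq_sqrt h]
    · exact h.trans (sq_nonneg _)
  have hb : b ≤ √b ^ 2 := by
    rcases le_total 0 b with h | h
    · rw [sq_sqrt h]
    · exact h.trans (sq_nonneg _)
  nlinarith [mul_nonneg (sqrt_nonneg a) (sqrt_nonneg b)]

lemma integral_abs_sphericalGaussian_sub_le (hσ₁ : 0 < σ₁) (hσ₂ : 0 < σ₂) :
    ∫ x, |sphericalGaussian d μ₁ σ₁ x - sphericalGaussian d μ₂ σ₂ x| ≤
      √(2 * π) * ‖μ₁ - μ₂‖ / σ₂ + √(d * |σ₁ ^ 2 - σ₂ ^ 2|) / σ₂ +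
        √(2 * d * log (σ₂ / σ₁)) := by
  have e₁ : √(2 * π) * ‖μ₁ - μ₂‖ / σ₂ = √(2 * π * ‖μ₁ - μ₂‖ ^ 2 / σ₂ ^ 2) := by
    rw [sqrt_div (by positivity), sqrt_mul (by positivity) (‖μ₁ - μ₂‖ ^ 2),
      sqrt_sq (norm_nonneg _), sqrt_sq hσ₂.le]
  have e₂ : √(d * |σ₁ ^ 2 - σ₂ ^ 2|) / σ₂ = √(d * |σ₁ ^ 2 - σ₂ ^ 2| / σ₂ ^ 2) := by
    rw [sqrt_div (by positivity), sqrt_sq hσ₂.le]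
  have hpinsker := integral_abs_sub_le_sqrt_integral_mul_log
    (sphericalGaussian_pos μ₁ hσ₁) (sphericalGaussian_pos μ₂ hσ₂)
    (integrable_sphericalGaussian μ₁ hσ₁) (integrable_sphericalGaussian μ₂ hσ₂)
    (integral_sphericalGaussian μ₁ hσ₁) (integral_sphericalGaussian μ₂ hσ₂)
    (integrable_sphericalGaussian_mul_log_div μ₁ μ₂ hσ₁ hσ₂)
  rw [integral_sphericalGaussian_mul_log_div μ₁ μ₂ hσ₁ hσ₂] at hpinsker
  rw [e₁, e₂]
  refine hpinsker.trans (le_trans (sqrt_le_sqrt ?_) ((sqrt_add_le_sqrt_add_sqrt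
    (2 * π * ‖μ₁ - μ₂‖ ^ 2 / σ₂ ^ 2 + d * |σ₁ ^ 2 - σ₂ ^ 2| / σ₂ ^ 2) _).trans
    (add_le_add_left (sqrt_add_le_sqrt_add_sqrt _ _) _)))
  have : d * (σ₁ ^ 2 - σ₂ ^ 2) / σ₂ ^ 2 ≤ d * |σ₁ ^ 2 - σ₂ ^ 2| / σ₂ ^ 2 := by
    gcongr
    exact le_abs_self _
  have e : 2 * (d * log (σ₂ / σ₁) + d * (σ₁ ^ 2 - σ₂ ^ 2) / (2 * σ₂ ^ 2) +
      π * ‖μ₁ - μ₂‖ ^ 2 / σ₂ ^ 2) = 2 * π * ‖μ₁ - μ₂‖ ^ 2 / σ₂ ^ 2 +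
      d * (σ₁ ^ 2 - σ₂ ^ 2) / σ₂ ^ 2 + 2 * d * log (σ₂ / σ₁) := by
    field_simp
    ring
  linarith

end TwoSphericalGaussians

lemma integral_abs_weighted_sub_le {α : Type*} [MeasurableSpace α] {μ : Measure α}
    {p q : α → ℝ} (hp : ∀ x, 0 ≤ p x) (hq : ∀ x, 0 ≤ q x)
    (hp_int : Integrable p μ) (hq_int : Integrable q μ)
    (hp_one : ∫ x, p x ∂μ = 1) (hq_one : ∫ x, q x ∂μ = 1)
    {v w : ℝ} (hv : 0 ≤ v) (hw : 0 ≤ w) :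
    ∫ x, |v * p x - w * q x| ∂μ ≤ |v - w| + min v w * ∫ x, |p x - q x| ∂μ := by
  have key {r : α → ℝ} (hr_int : Integrable r μ) (hr_one : ∫ x, r x ∂μ = 1) {m : ℝ}
      (h : ∀ x, |v * p x - w * q x| ≤ |v - w| * r x + m * |p x - q x|) :
      ∫ x, |v * p x - w * q x| ∂μ ≤ |v - w| + m * ∫ x, |p x - q x| ∂μ := by
    have i₁ := hr_int.const_mul |v - w|
    have i₂ : Integrable (fun x ↦ m * |p x - q x|) μ := (hp_int.sub hq_int).abs.const_mul m
    calc _ ≤ ∫ x, (|v - w| * r x + m * |p x - q x|) ∂μ :=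
          integral_mono ((hp_int.const_mul v).sub (hq_int.const_mul w)).abs (i₁.add i₂) h
      _ = _ := by
          rw [integral_add i₁ i₂, integral_const_mul, integral_const_mul, hr_one, mul_one]
  rcases le_total v w with h | h
  · rw [min_eq_left h]
    refine key hq_int hq_one fun x ↦ ?_
    calc |v * p x - w * q x| = |(v - w) * q x + v * (p x - q x)| := by ring_nf
      _ ≤ _ := abs_add_le _ _
      _ = _ := by rw [abs_mul, abs_mul, abs_of_nonneg (hq x), abs_of_nonneg hv]
  · rw [min_eq_right h]
    refine key hp_int hp_one fun x ↦ ?_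
    calc |v * p x - w * q x| = |(v - w) * p x + w * (p x - q x)| := by ring_nf
      _ ≤ _ := abs_add_le _ _
      _ = _ := by rw [abs_mul, abs_mul, abs_of_nonneg (hp x), abs_of_nonneg hw]

/-- L¹ distance bound between two weighted spherical Gaussian components. -/
theorem stmt_3 (d : ℕ) (μ₁ μ₂ : EuclideanSpace ℝ (Fin d)) (σ₁ σ₂ w₁ w₂ : ℝ)
    (hσ₁ : 0 < σ₁) (hσ₂ : 0 < σ₂)
    (hw₁ : 0 < w₁) (hw₁' : w₁ ≤ 1) (hw₂ : 0 < w₂) (hw₂' : w₂ ≤ 1) :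
    ∫ x, |w₁ * sphericalGaussian d μ₁ σ₁ x - w₂ * sphericalGaussian d μ₂ σ₂ x| ≤
      |w₁ - w₂| + min w₁ w₂ *
        (Real.sqrt (2 * π) * ‖μ₁ - μ₂‖ / σ₂ +
          Real.sqrt (d * |σ₁ ^ 2 - σ₂ ^ 2|) / σ₂ +
          Real.sqrt (2 * d * Real.log (σ₂ / σ₁))) := by
  refine (integral_abs_weighted_sub_le (fun x ↦ (sphericalGaussian_pos μ₁ hσ₁ x).le)
    (fun x ↦ (sphericalGaussian_pos μ₂ hσ₂ x).le) (integrable_sphericalGaussian μ₁ hσ₁)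
    (integrable_sphericalGaussian μ₂ hσ₂) (integral_sphericalGaussian μ₁ hσ₁)
    (integral_sphericalGaussian μ₂ hσ₂) hw₁.le hw₂.le).trans ?_
  gcongr
  exact integral_abs_sphericalGaussian_sub_le μ₁ μ₂ hσ₁ hσ₂
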